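/- Let A be an m×n matrix of hyperreals (a real matrix, each entry a singleton coset), B an n×p matrix over 𝔼, and C a p×q matrix of hyperreals. Then A(BC) = (AB)C. -/

import Mathlib

open scoped Pointwise Classical

noncomputable section

-- Note: `ℝ*` is Mathlib's notation for the hyperreals `Hyperreal`.

/-- A neutrix: an order-convex additive subgroup of the hyperreals. -/
def IsNeutrix (A : Set ℝ*) : Prop :=
  (0 : ℝ*) ∈ A ∧ (∀ x ∈ A, ∀ y ∈ A, x + y ∈ A) ∧ (∀ x ∈ A, -x ∈ A) ∧
    ∀ x ∈ A, ∀ y ∈ A, ∀ z : ℝ*, x ≤ z → z ≤ y → z ∈ A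

/-- The coset `a + A`. -/
def coset (a : ℝ*) (A : Set ℝ*) : Set ℝ* := {x | ∃ u ∈ A, x = a + u}

/-- `α` is an external number: a coset of a neutrix. -/
def IsExt (α : Set ℝ*) : Prop := ∃ a A, IsNeutrix A ∧ α = coset a A

/-- The neutrix part `N(α)` of an external number, as the set of differences. -/
def Nx (α : Set ℝ*) : Set ℝ* := {d | ∃ x ∈ α, ∃ y ∈ α, d = x - y}

/-- An external number is zeroless if it does not contain `0`. -/
def Zeroless (α : Set ℝ*) : Prop := (0 : ℝ*) ∉ α

/-- Multiplication of external numbers: `αβ = ab + aB + bA + AB`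
(independent of the chosen representatives). -/
def emul (α β : Set ℝ*) : Set ℝ* :=
  {z | ∃ a A b B, IsNeutrix A ∧ IsNeutrix B ∧ α = coset a A ∧ β = coset b B ∧
      ∃ u ∈ A, ∃ v ∈ B, ∃ u' ∈ A, ∃ v' ∈ B, z = a * b + a * v + b * u + u' * v'}

/-- Multiplication of an external number by a hyperreal scalar: `t·α = ta + tA`. -/
def esmul (t : ℝ*) (α : Set ℝ*) : Set ℝ* := (fun x => t * x) '' α

/-- Inverse of a (zeroless) external number: `1/α = 1/a + A/a²`. -/
def einv (α : Set ℝ*) : Set ℝ* :=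
  {z | ∃ a A, IsNeutrix A ∧ α = coset a A ∧ ∃ u ∈ A, z = a⁻¹ + u / a ^ 2}

/-- Division of external numbers: `α/β = α · (1/β)`. -/
def ediv (α β : Set ℝ*) : Set ℝ* := emul α (einv β)

/-- The neutrix `⊘` of infinitesimal hyperreals. -/
def oslash : Set ℝ* := {x | Hyperreal.Infinitesimal x}

/-- Relative uncertainty `R(α)`: `A/a` if `α = a + A` is zeroless,
and all of `ℝ*` if `α` is a neutrix. -/
def RU (α : Set ℝ*) : Set ℝ* :=
  if (0 : ℝ*) ∈ α then Set.univ
  else {z | ∃ a A, IsNeutrix A ∧ α = coset a A ∧ ∃ u ∈ A, z = u / a}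

/-- `α` and `β` are nearly opposite: both zeroless and `α/β ⊆ -1 + ⊘`. -/
def NearlyOpposite (α β : Set ℝ*) : Prop :=
  Zeroless α ∧ Zeroless β ∧ ediv α β ⊆ coset (-1) oslash

/-- Order on external numbers: `α ≤ β` iff `∀ x ∈ α, ∃ y ∈ β, x ≤ y`. -/
def ele (α β : Set ℝ*) : Prop := ∀ x ∈ α, ∃ y ∈ β, x ≤ y

/-- `α` is non-negative: some element of `α` is `≥ 0`. -/
def eNonneg (α : Set ℝ*) : Prop := ∃ x ∈ α, (0 : ℝ*) ≤ x

/-- Absolute value of an external number: `|α| = |a| + A`. -/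
def eabs (α : Set ℝ*) : Set ℝ* :=
  {z | ∃ a A, IsNeutrix A ∧ α = coset a A ∧ ∃ u ∈ A, z = |a| + u}

/-- Product of a finite family of external numbers. -/
def eprod : ∀ {n : ℕ}, (Fin n → Set ℝ*) → Set ℝ*
  | 0, _ => {1}
  | _ + 1, f => emul (f 0) (eprod fun i => f i.succ)

/-- Power of an external number. -/
def epow (α : Set ℝ*) : ℕ → Set ℝ*
  | 0 => {1}
  | k + 1 => emul α (epow α k)

/-- Matrix product over external numbers: `(AB)_{ij} = Σ_k α_{ik}β_{kj}`. -/
def matMul {m n p : ℕ} (M : Matrix (Fin m) (Fin n) (Set ℝ*))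
    (N : Matrix (Fin n) (Fin p) (Set ℝ*)) : Matrix (Fin m) (Fin p) (Set ℝ*) :=
  fun i j => ∑ k, emul (M i k) (N k j)

/-- Entrywise (Minkowski) sum of matrices over external numbers. -/
def matAdd {m n : ℕ} (M N : Matrix (Fin m) (Fin n) (Set ℝ*)) :
    Matrix (Fin m) (Fin n) (Set ℝ*) := fun i j => M i j + N i j

/-- Entrywise scalar multiple of a matrix by an external number. -/
def matSmul {m n : ℕ} (α : Set ℝ*) (M : Matrix (Fin m) (Fin n) (Set ℝ*)) :
    Matrix (Fin m) (Fin n) (Set ℝ*) := fun i j => emul α (M i j)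

/-- Entrywise inclusion of matrices over external numbers. -/
def matIncl {m n : ℕ} (M N : Matrix (Fin m) (Fin n) (Set ℝ*)) : Prop :=
  ∀ i j, M i j ⊆ N i j

/-- Determinant of a square matrix over the external numbers. -/
def detE {n : ℕ} (M : Matrix (Fin n) (Fin n) (Set ℝ*)) : Set ℝ* :=
  ∑ σ : Equiv.Perm (Fin n),
    esmul ((Equiv.Perm.sign σ : ℤ) : ℝ*) (eprod fun i => M i (σ i))

/-- The `(i,j)` minor of a square matrix over the external numbers. -/
def minorE {n : ℕ} (M : Matrix (Fin (n + 1)) (Fin (n + 1)) (Set ℝ*))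
    (i j : Fin (n + 1)) : Set ℝ* :=
  detE (M.submatrix i.succAbove j.succAbove)

/-- The near-identity matrix `I_n(N)`: diagonal entries `1 + N`, off-diagonal entries `N`. -/
def Iun (n : ℕ) (N : Set ℝ*) : Matrix (Fin n) (Fin n) (Set ℝ*) :=
  fun i j => if i = j then coset 1 N else N

/-- A finite family of vectors of external numbers is linearly dependent:
some nontrivial real (hyperreal) linear combination is a neutrix vector. -/
def LinDepE {ι : Type*} [Fintype ι] {n : ℕ} (ξ : ι → Fin n → Set ℝ*) : Prop :=
  ∃ t : ι → ℝ*, (∃ i, t i ≠ 0) ∧ ∃ A : Fin n → Set ℝ*,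
    (∀ j, IsNeutrix (A j)) ∧ ∀ j, (∑ i, esmul (t i) (ξ i j)) = A j

/-- The matrix has a zeroless minor of order `k`. -/
def HasZerolessMinor {m n : ℕ} (M : Matrix (Fin m) (Fin n) (Set ℝ*)) (k : ℕ) : Prop :=
  ∃ (f : Fin k → Fin m) (g : Fin k → Fin n), Function.Injective f ∧ Function.Injective g ∧
    Zeroless (detE fun i j => M (f i) (g j))

/-- The minor rank of `M` is `r`. -/
def minorRankIs {m n : ℕ} (M : Matrix (Fin m) (Fin n) (Set ℝ*)) (r : ℕ) : Prop :=
  HasZerolessMinor M r ∧ ∀ k, HasZerolessMinor M k → k ≤ r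

/-- The row rank of `M` is `r`: the maximal cardinality of a linearly
independent set of row vectors of `M` is `r`. -/
def rowRankIs {m n : ℕ} (M : Matrix (Fin m) (Fin n) (Set ℝ*)) (r : ℕ) : Prop :=
  (∃ s : Finset (Fin m), s.card = r ∧ ¬ LinDepE fun (i : {x // x ∈ s}) j => M i.1 j) ∧
  ∀ s : Finset (Fin m), (¬ LinDepE fun (i : {x // x ∈ s}) j => M i.1 j) → s.card ≤ r

/-- `M` is a reduced matrix: `max_{i,j} |α_{ij}| = 1 + A₀` for some neutrix `A₀ ⊆ ⊘`. -/
def IsReducedMat {m n : ℕ} (M : Matrix (Fin m) (Fin n) (Set ℝ*)) : Prop :=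
  ∃ A₀, IsNeutrix A₀ ∧ A₀ ⊆ oslash ∧ (∃ i j, eabs (M i j) = coset 1 A₀) ∧
    ∀ i j, ele (eabs (M i j)) (coset 1 A₀)

theorem coset_eq_singleton_add (a : ℝ*) (A : Set ℝ*) : coset a A = {a} + A := by
  ext x
  rw [Set.singleton_add]
  exact exists_congr fun u => and_congr_right fun _ => eq_comm

theorem isNeutrix_zero : IsNeutrix (0 : Set ℝ*) := by
  refine ⟨rfl, ?_, ?_, ?_⟩
  · rintro x rfl y rfl
    simp
  · rintro x rfl
    simp
  · rintro x rfl y rfl z h₁ h₂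
    exact le_antisymm h₂ h₁

theorem IsNeutrix.add {A B : Set ℝ*} (hA : IsNeutrix A) (hB : IsNeutrix B) :
    IsNeutrix (A + B) := by
  obtain ⟨zA, aA, nA, cA⟩ := hA
  obtain ⟨zB, aB, nB, cB⟩ := hB
  have pos : ∀ a ∈ A, ∀ b ∈ B, ∀ z : ℝ*, 0 ≤ z → z ≤ a + b → z ∈ A + B := by
    intro a ha b hb z hz hzab
    by_cases h : z ≤ a
    · exact ⟨z, cA 0 zA a ha z hz h, 0, zB, add_zero z⟩
    · exact ⟨a, ha, z - a, cB 0 zB b hb _ (by linarith) (by linarith), by ring⟩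
  have neg : ∀ x ∈ A + B, -x ∈ A + B := by
    rintro _ ⟨a, ha, b, hb, rfl⟩
    exact ⟨-a, nA a ha, -b, nB b hb, by ring⟩
  refine ⟨⟨0, zA, 0, zB, add_zero 0⟩, ?_, neg, ?_⟩
  · rintro _ ⟨a, ha, b, hb, rfl⟩ _ ⟨a', ha', b', hb', rfl⟩
    exact ⟨a + a', aA a ha a' ha', b + b', aB b hb b' hb', by ring⟩
  · rintro _ ⟨a, ha, b, hb, rfl⟩ _ ⟨a', ha', b', hb', rfl⟩ z h₁ h₂
    rcases le_total 0 z with hz | hz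
    · exact pos a' ha' b' hb' z hz h₂
    · have := neg _ (pos (-a) (nA a ha) (-b) (nB b hb) (-z) (by linarith)
        (by simp only at h₁; linarith))
      simpa using this

theorem IsNeutrix.smul (t : ℝ*) {A : Set ℝ*} (hA : IsNeutrix A) : IsNeutrix (t • A) := by
  rcases eq_or_ne t 0 with rfl | ht
  · rw [Set.zero_smul_set ⟨0, hA.1⟩]
    exact isNeutrix_zero
  obtain ⟨zA, aA, nA, cA⟩ := hA
  simp only [IsNeutrix, Set.mem_smul_set_iff_inv_smul_mem₀ ht, smul_eq_mul]
  refine ⟨by simpa using zA, ?_, ?_, ?_⟩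
  · intro x hx y hy
    rw [mul_add]
    exact aA _ hx _ hy
  · intro x hx
    rw [mul_neg]
    exact nA _ hx
  · intro x hx y hy z h₁ h₂
    rcases le_total 0 t⁻¹ with h | h
    · exact cA _ hx _ hy _ (mul_le_mul_of_nonneg_left h₁ h) (mul_le_mul_of_nonneg_left h₂ h)
    · exact cA _ hy _ hx _ (mul_le_mul_of_nonpos_left h₂ h) (mul_le_mul_of_nonpos_left h₁ h)

theorem isExt_zero : IsExt 0 :=
  ⟨0, 0, isNeutrix_zero, by rw [coset_eq_singleton_add, Set.singleton_zero, add_zero]⟩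

theorem IsExt.add {α β : Set ℝ*} (hα : IsExt α) (hβ : IsExt β) : IsExt (α + β) := by
  obtain ⟨a, A, hA, rfl⟩ := hα
  obtain ⟨b, B, hB, rfl⟩ := hβ
  refine ⟨a + b, A + B, hA.add hB, ?_⟩
  rw [coset_eq_singleton_add, coset_eq_singleton_add, coset_eq_singleton_add,
    ← Set.singleton_add_singleton,
    add_add_add_comm]

theorem IsExt.smul (t : ℝ*) {α : Set ℝ*} (hα : IsExt α) : IsExt (t • α) := by
  obtain ⟨a, A, hA, rfl⟩ := hα
  refine ⟨t * a, t • A, hA.smul t, ?_⟩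
  rw [coset_eq_singleton_add, coset_eq_singleton_add, smul_add, Set.smul_set_singleton, smul_eq_mul]

theorem IsExt.sum {ι : Type*} (s : Finset ι) {f : ι → Set ℝ*} (hf : ∀ i, IsExt (f i)) :
    IsExt (∑ i ∈ s, f i) :=
  Finset.sum_induction f IsExt (fun _ _ => IsExt.add) isExt_zero fun i _ => hf i

theorem emul_comm (α β : Set ℝ*) : emul α β = emul β α := by
  have key : ∀ α β : Set ℝ*, emul α β ⊆ emul β α := by
    rintro α β z ⟨a, A, b, B, hA, hB, hα, hβ, u, hu, v, hv, u', hu', v', hv', rfl⟩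
    exact ⟨b, B, a, A, hB, hA, hβ, hα, v, hv, u, hu, v', hv', u', hu', by ring⟩
  exact (key α β).antisymm (key β α)

theorem eq_and_eq_zero_of_singleton_eq_coset {t a : ℝ*} {A : Set ℝ*} (hA : IsNeutrix A)
    (h : {t} = coset a A) : a = t ∧ ∀ u ∈ A, u = 0 := by
  have mem : ∀ u ∈ A, a + u = t := by
    intro u hu
    have : a + u ∈ ({t} : Set ℝ*) := h ▸ ⟨u, hu, rfl⟩
    exact this
  have ha : a = t := by simpa using mem 0 hA.1
  exact ⟨ha, fun u hu => by simpa [ha] using mem u hu⟩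

theorem singleton_emul (t : ℝ*) {β : Set ℝ*} (hβ : IsExt β) : emul {t} β = t • β := by
  ext z
  constructor
  · rintro ⟨a, A, b, B, hA, hB, ht, rfl, u, hu, v, hv, u', hu', v', hv', rfl⟩
    obtain ⟨rfl, hA₀⟩ := eq_and_eq_zero_of_singleton_eq_coset hA ht
    exact ⟨b + v, ⟨v, hv, rfl⟩, by simp [hA₀ u hu, hA₀ u' hu', mul_add]⟩
  · obtain ⟨b, B, hB, rfl⟩ := hβ
    rintro ⟨_, ⟨v, hv, rfl⟩, rfl⟩
    exact ⟨t, 0, b, B, isNeutrix_zero, hB, by simp [coset_eq_singleton_add], rfl, 0, rfl, v, hv,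
      0, rfl,
      v, hv, by simp [mul_add]⟩

theorem emul_singleton (t : ℝ*) {β : Set ℝ*} (hβ : IsExt β) : emul β {t} = t • β := by
  rw [emul_comm, singleton_emul t hβ]

theorem stmt5 {m n p q : ℕ} (A : Matrix (Fin m) (Fin n) (Set ℝ*))
    (B : Matrix (Fin n) (Fin p) (Set ℝ*)) (C : Matrix (Fin p) (Fin q) (Set ℝ*))
    (hA : ∀ i j, ∃ a : ℝ*, A i j = {a}) (hB : ∀ i j, IsExt (B i j))
    (hC : ∀ i j, ∃ c : ℝ*, C i j = {c}) :
    matMul A (matMul B C) = matMul (matMul A B) C := by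
  choose a ha using hA
  choose c hc using hC
  ext1 i j
  have hBC : ∀ k, (∑ l, emul (B k l) (C l j)) = ∑ l, c l j • B k l := fun k =>
    Finset.sum_congr rfl fun l _ => by rw [hc, emul_singleton _ (hB k l)]
  have hAB : ∀ l, (∑ k, emul (A i k) (B k l)) = ∑ k, a i k • B k l := fun l =>
    Finset.sum_congr rfl fun k _ => by rw [ha, singleton_emul _ (hB k l)]
  calc (∑ k, emul (A i k) (∑ l, emul (B k l) (C l j)))
      = ∑ k, ∑ l, a i k • c l j • B k l := Finset.sum_congr rfl fun k _ => by
        rw [hBC, ha, singleton_emul _ (IsExt.sum _ fun l => (hB k l).smul _), Finset.smul_sum]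
    _ = ∑ l, ∑ k, c l j • a i k • B k l := by
        rw [Finset.sum_comm]
        simp only [smul_comm (a i _) (c _ j)]
    _ = ∑ l, emul (∑ k, emul (A i k) (B k l)) (C l j) := Finset.sum_congr rfl fun l _ => by
        rw [hAB, hc, emul_singleton _ (IsExt.sum _ fun k => (hB k l).smul _), Finset.smul_sum]
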